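/- With high probability, for every integer y with (1/2)·√(n·ln n·(1−ζ₂)) − 2 ≤ |y − n/2| ≤ (1/2)·√(n·ln n·(1−ζ₁)) + 2, it holds that N_y ≤ (ln n)². -/

import Mathlib

open Filter

/-- The degree of a vertex in a (possibly non-decidable) simple graph. -/
noncomputable def ndeg {V : Type*} (G : SimpleGraph V) (v : V) : ℕ :=
  Nat.card (G.neighborSet v)

/-- The probability that a uniformly random graph on the (finite) vertex type `V`
belongs to the set `A`. -/
noncomputable def gprob {V : Type*} (A : Set (SimpleGraph V)) : ℝ :=
  (Nat.card A : ℝ) / 2 ^ (Nat.card V).choose 2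

/-- `N_y`: the number of vertices of degree `y` in a graph on `Fin n`. -/
noncomputable def Ncount {n : ℕ} (G : SimpleGraph (Fin n)) (y : ℤ) : ℕ :=
  Set.ncard {v : Fin n | (ndeg G v : ℤ) = y}

/-- `ζ₁ = (ln(2π) + (3/2)·ln ln n) / ln n`. -/
noncomputable def zeta1 (n : ℕ) : ℝ :=
  (Real.log (2 * Real.pi) + (3 / 2) * Real.log (Real.log n)) / Real.log n

/-- `ζ₂ = (ln(2π) + (5/2)·ln ln n) / ln n`. -/
noncomputable def zeta2 (n : ℕ) : ℝ :=
  (Real.log (2 * Real.pi) + (5 / 2) * Real.log (Real.log n)) / Real.log n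

/-- A simple graph is determined by an arbitrary set of non-loop pairs. -/
def simpleGraphEquivSet (V : Type*) :
    SimpleGraph V ≃ Set ((Sym2.diagSet : Set (Sym2 V))ᶜ : Set (Sym2 V)) where
  toFun G := {e | (e : Sym2 V) ∈ G.edgeSet}
  invFun s := SimpleGraph.fromEdgeSet (Subtype.val '' s)
  left_inv G := by
    ext a b
    simp only [SimpleGraph.fromEdgeSet_adj, Set.mem_image, Set.mem_ofPred_eq]
    constructor
    · rintro ⟨⟨e, he, h⟩, -⟩
      rw [h] at he
      exact he
    · intro h
      exact ⟨⟨⟨s(a, b), by simpa using h.ne⟩, h, rfl⟩, h.ne⟩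
  right_inv s := by
    ext ⟨e, he⟩
    simp only [SimpleGraph.edgeSet_fromEdgeSet, Set.mem_ofPred_eq, Set.mem_sdiff, Set.mem_image,
      Subtype.exists, exists_and_right, exists_eq_right]
    exact ⟨fun h => h.1.2, fun h => ⟨⟨he, h⟩, he⟩⟩

theorem natCard_simpleGraph (V : Type*) [Finite V] :
    Nat.card (SimpleGraph V) = 2 ^ (Nat.card V).choose 2 := by
  classical
  have := Fintype.ofFinite V
  rw [Nat.card_congr (simpleGraphEquivSet V), ← Sym2.ncard_diagSet_compl, Nat.card_eq_fintype_card,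
    Fintype.card_set, ← Nat.card_eq_fintype_card]
  rfl

/-- A graph on `A ⊕ B` consists of a graph on `A`, a graph on `B`, and the neighbourhoods in `B`
of the vertices of `A`. -/
def simpleGraphSumEquiv (A B : Type*) :
    SimpleGraph (A ⊕ B) ≃ (SimpleGraph A × SimpleGraph B) × (A → Set B) where
  toFun G := ((G.comap Sum.inl, G.comap Sum.inr), fun a => {b | G.Adj (Sum.inl a) (Sum.inr b)})
  invFun P :=
    { Adj := fun x y => match x, y with
        | .inl a, .inl a' => P.1.1.Adj a a'
        | .inr b, .inr b' => P.1.2.Adj b b'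
        | .inl a, .inr b => b ∈ P.2 a
        | .inr b, .inl a => b ∈ P.2 a
      symm := ⟨by
        rintro (a | b) (a' | b') h
        · exact SimpleGraph.Adj.symm h
        · exact h
        · exact h
        · exact SimpleGraph.Adj.symm h⟩
      loopless := ⟨by
        rintro (a | b) h
        · exact P.1.1.loopless.irrefl a h
        · exact P.1.2.loopless.irrefl b h⟩ }
  left_inv G := by
    ext x y
    rcases x with a | b <;> rcases y with a' | b' <;> simp [SimpleGraph.adj_comm]
  right_inv P := by
    rcases P with ⟨⟨P, Q⟩, f⟩
    rfl

theorem ndeg_inl {A B : Type*} [Finite A] [Finite B] (G : SimpleGraph (A ⊕ B)) (a : A) :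
    ndeg G (Sum.inl a) =
      ((simpleGraphSumEquiv A B G).2 a).ncard + ndeg (simpleGraphSumEquiv A B G).1.1 a := by
  have h : G.neighborSet (Sum.inl a) =
      Sum.inr '' ((simpleGraphSumEquiv A B G).2 a) ∪
        Sum.inl '' ((simpleGraphSumEquiv A B G).1.1.neighborSet a) := by
    ext x
    rcases x with x | x <;> simp [simpleGraphSumEquiv]
  unfold ndeg
  rw [Nat.card_coe_set_eq, Nat.card_coe_set_eq, h, Set.ncard_union_eq,
    Set.ncard_image_of_injective _ Sum.inr_injective,
    Set.ncard_image_of_injective _ Sum.inl_injective]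
  rw [Set.disjoint_left]
  rintro x ⟨b, -, rfl⟩ ⟨a, -, h⟩
  cases h

theorem ndeg_le_card {V : Type*} [Finite V] (G : SimpleGraph V) (v : V) :
    ndeg G v ≤ Nat.card V :=
  Nat.card_le_card_of_injective _ Subtype.val_injective

theorem natCard_set_ncard_eq (B : Type*) [Finite B] (k : ℕ) :
    Nat.card {t : Set B // t.ncard = k} = (Nat.card B).choose k := by
  classical
  have := Fintype.ofFinite B
  rw [Nat.card_eq_fintype_card (α := B), ← Fintype.card_finset_len, ← Nat.card_eq_fintype_card]
  exact Nat.card_congr (Equiv.subtypeEquiv Fintype.finsetEquivSet.symm fun t => by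
    rw [Set.ncard_eq_toFinset_card']
    congr!)

/-- If every binomial probability that may arise is at most `q`, the probability that all
vertices of `A` have degree `y` is at most `q ^ |A|`. -/
theorem natCard_forall_ndeg_inl_eq_le {A B : Type*} [Finite A] [Finite B] (y : ℕ) (q : ℝ)
    (hq : 0 ≤ q)
    (h : ∀ d k : ℕ, d ≤ Nat.card A → k + d = y →
      ((Nat.card B).choose k : ℝ) ≤ q * 2 ^ Nat.card B) :
    (Nat.card {G : SimpleGraph (A ⊕ B) // ∀ a, ndeg G (Sum.inl a) = y} : ℝ) ≤
      q ^ Nat.card A * Nat.card (SimpleGraph (A ⊕ B)) := by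
  classical
  have := Fintype.ofFinite A
  have := Fintype.ofFinite B
  have := Fintype.ofFinite (SimpleGraph A × SimpleGraph B)
  have e : {G : SimpleGraph (A ⊕ B) // ∀ a, ndeg G (Sum.inl a) = y} ≃
      Σ P : SimpleGraph A × SimpleGraph B,
        ∀ a, {t : Set B // t.ncard + ndeg P.1 a = y} :=
    { toFun := fun G => ⟨(simpleGraphSumEquiv A B G).1, fun a =>
        ⟨(simpleGraphSumEquiv A B G).2 a, by rw [← ndeg_inl]; exact G.2 a⟩⟩
      invFun := fun P => ⟨(simpleGraphSumEquiv A B).symm (P.1, fun a => P.2 a), fun a => by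
        rw [ndeg_inl]; simpa using (P.2 a).2⟩
      left_inv := fun G => by
        apply Subtype.ext
        exact (simpleGraphSumEquiv A B).symm_apply_apply G
      right_inv := fun P => rfl }
  rw [Nat.card_congr e, Nat.card_sigma, Nat.card_congr (simpleGraphSumEquiv A B), Nat.card_prod,
    Nat.card_pi]
  have hb : ∀ (P : SimpleGraph A × SimpleGraph B) (a : A),
      (Nat.card {t : Set B // t.ncard + ndeg P.1 a = y} : ℝ) ≤ q * 2 ^ Nat.card B := by
    intro P a
    by_cases hd : ndeg P.1 a ≤ y
    · have := h (ndeg P.1 a) (y - ndeg P.1 a) (ndeg_le_card _ _) (by omega)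
      rw [← natCard_set_ncard_eq] at this
      refine le_of_eq_of_le ?_ this
      congr 1
      exact Nat.card_congr (Equiv.subtypeEquivRight fun t => by omega)
    · have : IsEmpty {t : Set B // t.ncard + ndeg P.1 a = y} := ⟨fun t => by have := t.2; omega⟩
      rw [Nat.card_of_isEmpty]
      push_cast
      positivity
  calc ((∑ P : SimpleGraph A × SimpleGraph B,
        Nat.card (∀ a, {t : Set B // t.ncard + ndeg P.1 a = y}) : ℕ) : ℝ)
      ≤ ∑ P : SimpleGraph A × SimpleGraph B, ∏ a : A, (q * 2 ^ Nat.card B) := by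
        push_cast [Nat.card_pi]
        exact Finset.sum_le_sum fun P _ =>
          Finset.prod_le_prod (fun _ _ => Nat.cast_nonneg _) fun a _ => hb P a
    _ = _ := by
        have hB : Nat.card (Set B) = 2 ^ Nat.card B := by
          simp [Nat.card_eq_fintype_card]
        simp only [Finset.prod_const, Finset.sum_const, Finset.card_univ, hB, nsmul_eq_mul,
          ← Nat.card_eq_fintype_card]
        push_cast
        rw [mul_pow]
        ring

theorem ndeg_map_equiv {V W : Type*} (e : V ≃ W) (G : SimpleGraph V) (v : V) :
    ndeg (e.simpleGraph G) (e v) = ndeg G v := by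
  unfold ndeg
  refine Nat.card_congr (Equiv.subtypeEquiv e.symm fun w => ?_)
  simp [Equiv.simpleGraph]

theorem natCard_forall_mem_ndeg_eq_le {V : Type*} [Finite V] (S : Set V) (y : ℕ) (q : ℝ)
    (hq : 0 ≤ q)
    (h : ∀ d k : ℕ, d ≤ S.ncard → k + d = y →
      ((Sᶜ.ncard).choose k : ℝ) ≤ q * 2 ^ Sᶜ.ncard) :
    (Nat.card {G : SimpleGraph V // ∀ v ∈ S, ndeg G v = y} : ℝ) ≤
      q ^ S.ncard * Nat.card (SimpleGraph V) := by
  classical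
  let e : V ≃ S ⊕ (Sᶜ : Set V) := (Equiv.Set.sumCompl S).symm
  have key := natCard_forall_ndeg_inl_eq_le (A := S) (B := (Sᶜ : Set V)) y q hq h
  rw [← Nat.card_congr e.simpleGraph] at key
  refine le_trans (le_of_eq ?_) key
  congr 1
  refine Nat.card_congr (Equiv.subtypeEquiv e.simpleGraph fun G => ?_)
  have he : ∀ a : S, e a = Sum.inl a := fun a => by simp [e]
  constructor
  · intro hG a
    rw [← he, ndeg_map_equiv]
    exact hG a a.2
  · intro hG v hv
    rw [← hG ⟨v, hv⟩, ← he, ndeg_map_equiv]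

theorem gprob_le_one {V : Type*} [Finite V] (A : Set (SimpleGraph V)) : gprob A ≤ 1 := by
  unfold gprob
  rw [div_le_one (by positivity)]
  have h := Nat.card_le_card_of_injective (Subtype.val : A → SimpleGraph V)
    Subtype.val_injective
  rw [natCard_simpleGraph] at h
  exact_mod_cast h

theorem gprob_mono {V : Type*} [Finite V] {A B : Set (SimpleGraph V)} (h : A ⊆ B) :
    gprob A ≤ gprob B := by
  unfold gprob
  gcongr
  exact Nat.card_mono (Set.toFinite B) h

theorem gprob_eq_one_sub {V : Type*} [Finite V] (A : Set (SimpleGraph V)) :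
    gprob A = 1 - gprob Aᶜ := by
  unfold gprob
  have h := Set.ncard_add_ncard_compl A
  rw [natCard_simpleGraph, ← Nat.card_coe_set_eq, ← Nat.card_coe_set_eq] at h
  have h' : (Nat.card A : ℝ) + Nat.card (Aᶜ : Set (SimpleGraph V)) =
      2 ^ (Nat.card V).choose 2 := by exact_mod_cast h
  rw [eq_sub_iff_add_eq, ← add_div, h', div_self (by positivity)]

theorem gprob_biUnion_le {V ι : Type*} [Finite V] (s : Finset ι) (A : ι → Set (SimpleGraph V)) :
    gprob (⋃ i ∈ s, A i) ≤ ∑ i ∈ s, gprob (A i) := by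
  unfold gprob
  rw [← Finset.sum_div]
  gcongr
  simp only [Nat.card_coe_set_eq]
  exact_mod_cast Finset.set_ncard_biUnion_le s A

theorem gprob_forall_mem_ndeg_eq_le {V : Type*} [Finite V] (S : Set V) (y : ℕ) (q : ℝ)
    (hq : 0 ≤ q)
    (h : ∀ d k : ℕ, d ≤ S.ncard → k + d = y →
      ((Sᶜ.ncard).choose k : ℝ) ≤ q * 2 ^ Sᶜ.ncard) :
    gprob {G : SimpleGraph V | ∀ v ∈ S, ndeg G v = y} ≤ q ^ S.ncard := by
  unfold gprob
  rw [div_le_iff₀ (by positivity)]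
  have := natCard_forall_mem_ndeg_eq_le S y q hq h
  rw [natCard_simpleGraph] at this
  exact_mod_cast this

/-- Union bound over the degree `y` and over the sets of `r` vertices of degree `y`. -/
theorem one_sub_le_gprob_forall_Ncount_le {n r : ℕ} {K q : ℝ} (hK₀ : 0 ≤ K)
    (hK : ∀ N : ℕ, K < N → r ≤ N) (hq : 0 ≤ q) (P : ℤ → Prop)
    (h : ∀ y : ℕ, P y → ∀ d k : ℕ, d ≤ r → k + d = y →
      ((n - r).choose k : ℝ) ≤ q * 2 ^ (n - r)) :
    1 - (n + 1) * (n.choose r * q ^ r) ≤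
      gprob {G : SimpleGraph (Fin n) | ∀ y : ℤ, P y → (Ncount G y : ℝ) ≤ K} := by
  classical
  rw [gprob_eq_one_sub, sub_le_sub_iff_left]
  let I : Finset (ℕ × Finset (Fin n)) :=
    ((Finset.range (n + 1)).filter fun y : ℕ => P y) ×ˢ Finset.powersetCard r Finset.univ
  let A : ℕ × Finset (Fin n) → Set (SimpleGraph (Fin n)) :=
    fun i => {G | ∀ v ∈ (i.2 : Set (Fin n)), ndeg G v = i.1}
  have hsub : {G : SimpleGraph (Fin n) | ∀ y : ℤ, P y → (Ncount G y : ℝ) ≤ K}ᶜ ⊆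
      ⋃ i ∈ I, A i := by
    intro G hG
    simp only [Set.mem_compl_iff, Set.mem_ofPred_eq, not_forall, not_le] at hG
    obtain ⟨y, hy, hN⟩ := hG
    have hpos : 0 < Ncount G y := by exact_mod_cast hK₀.trans_lt hN
    obtain ⟨v, hv⟩ := Set.nonempty_of_ncard_ne_zero hpos.ne'
    obtain ⟨S, hS, hSr⟩ := Set.exists_subset_card_eq (hK _ hN)
    refine Set.mem_biUnion (x := (ndeg G v, S.toFinset)) ?_ ?_
    · have hle := ndeg_le_card G v
      rw [Nat.card_fin] at hle
      have hv' : (ndeg G v : ℤ) = y := hv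
      simp only [I, Finset.mem_coe, Finset.mem_product, Finset.mem_filter, Finset.mem_range,
        Finset.mem_powersetCard, Finset.subset_univ, true_and]
      exact ⟨⟨by omega, by rwa [hv']⟩, by rw [← hSr, Set.ncard_eq_toFinset_card']⟩
    · intro w hw
      have hw' : (ndeg G w : ℤ) = y := hS (by simpa using hw)
      have hv' : (ndeg G v : ℤ) = y := hv
      exact_mod_cast hw'.trans hv'.symm
  refine (gprob_mono hsub).trans ((gprob_biUnion_le I A).trans ?_)
  have hA : ∀ i ∈ I, gprob (A i) ≤ q ^ r := by
    rintro ⟨y, S⟩ hi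
    simp only [I, Finset.mem_product, Finset.mem_filter, Finset.mem_powersetCard,
      Finset.subset_univ, true_and] at hi
    have hS : (S : Set (Fin n)).ncard = r := by rw [Set.ncard_coe_finset, hi.2]
    have hS' : ((S : Set (Fin n))ᶜ).ncard = n - r := by
      rw [Set.ncard_compl, hS, Nat.card_fin]
    have := gprob_forall_mem_ndeg_eq_le (S : Set (Fin n)) y q hq
    rw [hS, hS'] at this
    exact this (h y hi.1.2)
  refine (Finset.sum_le_card_nsmul I _ _ hA).trans ?_
  rw [nsmul_eq_mul, ← mul_assoc]
  gcongr
  have hI : I.card ≤ (n + 1) * n.choose r := by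
    rw [Finset.card_product, Finset.card_powersetCard, Finset.card_univ, Fintype.card_fin]
    gcongr
    exact (Finset.card_filter_le _ _).trans (Finset.card_range _).le
  exact_mod_cast hI

theorem centralBinom_sq_mul_le (a : ℕ) : a.centralBinom ^ 2 * (2 * a + 1) ≤ 16 ^ a := by
  induction a with
  | zero => simp
  | succ a ih =>
    have h := Nat.succ_mul_centralBinom_succ a
    refine Nat.le_of_mul_le_mul_left (c := (a + 1) ^ 2) ?_ (by positivity)
    calc (a + 1) ^ 2 * ((a + 1).centralBinom ^ 2 * (2 * (a + 1) + 1))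
        = ((a + 1) * (a + 1).centralBinom) ^ 2 * (2 * (a + 1) + 1) := by ring
      _ = 4 * ((2 * a + 1) * (2 * a + 3)) * (a.centralBinom ^ 2 * (2 * a + 1)) := by rw [h]; ring
      _ ≤ 4 * (4 * (a + 1) ^ 2) * 16 ^ a :=
          Nat.mul_le_mul (Nat.mul_le_mul_left _ (by nlinarith)) ih
      _ = (a + 1) ^ 2 * 16 ^ (a + 1) := by ring

theorem centralBinom_le_div_sqrt (a : ℕ) :
    (a.centralBinom : ℝ) ≤ 2 ^ (2 * a) / √(2 * a + 1) := by
  rw [le_div_iff₀ (by positivity)]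
  refine abs_le_of_sq_le_sq' ?_ (by positivity) |>.2
  rw [mul_pow, Real.sq_sqrt (by positivity), ← pow_mul, mul_right_comm, pow_mul]
  norm_num
  exact_mod_cast centralBinom_sq_mul_le a

theorem one_sub_le_one_add_mul_exp {x : ℝ} (hx : 0 ≤ x) :
    1 - x ≤ (1 + x) * Real.exp (-(2 * x)) := by
  rcases le_or_gt 1 x with h1 | h1
  · have : 0 ≤ (1 + x) * Real.exp (-(2 * x)) := by positivity
    linarith
  have hs := Real.hasSum_log_sub_log_of_abs_lt_one (abs_lt.2 ⟨by linarith, h1⟩)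
  have h2 : 2 * x ≤ Real.log (1 + x) - Real.log (1 - x) := by
    have := le_hasSum hs 0 fun k _ => by positivity
    simpa using this
  have hp : 0 < 1 - x := by linarith
  calc 1 - x = Real.exp (Real.log (1 - x)) := (Real.exp_log hp).symm
    _ ≤ Real.exp (Real.log (1 + x) + -(2 * x)) := by gcongr; linarith
    _ = _ := by rw [Real.exp_add, Real.exp_log (by linarith)]

theorem choose_two_mul_add_le {a : ℕ} (ha : 0 < a) (j : ℕ) :
    ((2 * a).choose (a + j) : ℝ) ≤ a.centralBinom * Real.exp (-(j * (j - 1) / a)) := by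
  induction j with
  | zero => simp [Nat.centralBinom]
  | succ j ih =>
    rcases le_or_gt (2 * a) (a + j) with hj | hj
    · rw [Nat.choose_eq_zero_of_lt (by omega)]
      push_cast
      positivity
    have ha' : (0 : ℝ) < a := by exact_mod_cast ha
    have h := Nat.choose_succ_right_eq (2 * a) (a + j)
    have h' : ((2 * a).choose (a + (j + 1)) : ℝ) * (a + j + 1) =
        (2 * a).choose (a + j) * (a - j) := by
      have : ((2 * a - (a + j) : ℕ) : ℝ) = a - j := by
        rw [Nat.cast_sub hj.le]; push_cast; ring
      rw [← this]
      exact_mod_cast h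
    have hx : (a - j : ℝ) ≤ (a + j) * Real.exp (-(2 * (j / a))) := by
      have := mul_le_mul_of_nonneg_left
        (one_sub_le_one_add_mul_exp (x := (j / a : ℝ)) (by positivity)) ha'.le
      calc (a - j : ℝ) = a * (1 - j / a) := by field_simp
        _ ≤ _ := this
        _ = _ := by rw [← mul_assoc]; congr 1; field_simp
    refine le_of_mul_le_mul_right (a := (a + j + 1 : ℝ)) ?_ (by positivity)
    rw [h']
    calc ((2 * a).choose (a + j) : ℝ) * (a - j)
        ≤ (a.centralBinom * Real.exp (-(j * (j - 1) / a))) *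
            ((a + j + 1) * Real.exp (-(2 * (j / a)))) := by
          have hj' : (0 : ℝ) ≤ a - j := by
            have : (j : ℝ) ≤ a := by exact_mod_cast (by omega : j ≤ a)
            linarith
          refine mul_le_mul ih (hx.trans ?_) hj' (by positivity)
          exact mul_le_mul_of_nonneg_right (by linarith) (Real.exp_pos _).le
      _ = a.centralBinom * (Real.exp (-(j * (j - 1) / a)) * Real.exp (-(2 * (j / a)))) *
            (a + j + 1) := by ring
      _ = _ := by
          rw [← Real.exp_add]
          congr 3
          push_cast
          field_simp
          ring

/-- A local tail bound for the symmetric binomial distribution with an even number of trials. -/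
theorem choose_two_mul_le_of_abs_sub {a : ℕ} (ha : 0 < a) (k : ℕ) {x : ℝ} (hx : 0 ≤ x)
    (hk : x + 1 ≤ |(k : ℝ) - a|) :
    ((2 * a).choose k : ℝ) ≤ 2 ^ (2 * a) / √(2 * a + 1) * Real.exp (-(x ^ 2 / a)) := by
  rcases lt_or_ge (2 * a) k with h2 | h2
  · rw [Nat.choose_eq_zero_of_lt h2]
    push_cast
    positivity
  have key : ∀ j : ℕ, x + 1 ≤ j →
      ((2 * a).choose (a + j) : ℝ) ≤ 2 ^ (2 * a) / √(2 * a + 1) * Real.exp (-(x ^ 2 / a)) := by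
    intro j hj
    refine (choose_two_mul_add_le ha j).trans ?_
    gcongr
    · exact centralBinom_le_div_sqrt a
    · nlinarith
  rcases le_total a k with h | h
  · have hj : ((k - a : ℕ) : ℝ) = |(k : ℝ) - a| := by
      rw [Nat.cast_sub h, abs_of_nonneg]
      exact sub_nonneg.2 (by exact_mod_cast h)
    have := key (k - a) (hj ▸ hk)
    rwa [Nat.add_sub_cancel' h] at this
  · have hj : ((a - k : ℕ) : ℝ) = |(k : ℝ) - a| := by
      rw [Nat.cast_sub h, abs_sub_comm, abs_of_nonneg]
      exact sub_nonneg.2 (by exact_mod_cast h)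
    have := key (a - k) (hj ▸ hk)
    rwa [show a + (a - k) = 2 * a - k by omega, Nat.choose_symm h2] at this

/-- Far from the mean `n / 2`, the bound survives conditioning on the edges among `r` vertices. -/
theorem choose_le_of_far_from_mean {n r a y d k : ℕ} {E : ℝ} (hn : n = r + 2 * a) (ha : 0 < a)
    (hE : 0 ≤ E) (hs : (r : ℝ) / 2 + 3 ≤ 1 / 2 * √(n * E))
    (hs' : 4 * (1 / 2 * √(n * E)) * ((r : ℝ) / 2 + 3) ≤ n)
    (hy : 1 / 2 * √(n * E) - 2 ≤ |(y : ℝ) - n / 2|) (hd : d ≤ r) (hk : k + d = y) :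
    ((2 * a).choose k : ℝ) ≤ Real.exp (1 - E / 2) / √(2 * a + 1) * 2 ^ (2 * a) := by
  have hW2 : (1 / 2 * √(n * E)) ^ 2 = n * E / 4 := by
    rw [mul_pow, Real.sq_sqrt (by positivity)]
    ring
  set W := 1 / 2 * √(n * E) with hW
  have ha' : (0 : ℝ) < a := by exact_mod_cast ha
  have hn' : (n : ℝ) = r + 2 * a := by exact_mod_cast hn
  have hn0 : (0 : ℝ) < n := by rw [hn']; positivity
  have hk' : (y : ℝ) = k + d := by exact_mod_cast hk.symm
  have hd' : (d : ℝ) ≤ r := by exact_mod_cast hd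
  have hd0 : (0 : ℝ) ≤ d := Nat.cast_nonneg d
  have hdev : (W - (r / 2 + 3)) + 1 ≤ |(k : ℝ) - a| := by
    have h1 : |(y : ℝ) - n / 2| ≤ |(k : ℝ) - a| + |(d : ℝ) - r / 2| := by
      have : (y : ℝ) - n / 2 = (k - a) + (d - r / 2) := by rw [hk', hn']; ring
      rw [this]
      exact abs_add_le _ _
    have h2 : |(d : ℝ) - r / 2| ≤ r / 2 := abs_le.2 ⟨by linarith, by linarith⟩
    linarith
  refine (choose_two_mul_le_of_abs_sub ha k (by linarith) hdev).trans ?_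
  rw [div_mul_eq_mul_div, div_mul_eq_mul_div, mul_comm]
  gcongr
  have hx : E / 2 - 1 ≤ (W - (r / 2 + 3)) ^ 2 / a := by
    have h3 : (W - (r / 2 + 3)) ^ 2 / (n / 2) ≤ (W - (r / 2 + 3)) ^ 2 / a := by
      gcongr
      rw [hn']
      linarith [Nat.cast_nonneg (α := ℝ) r]
    refine le_trans ?_ h3
    rw [le_div_iff₀ (by positivity)]
    nlinarith [sq_nonneg ((r : ℝ) / 2 + 3)]
  linarith

theorem choose_mul_pow_le {n r : ℕ} {q : ℝ} (hq : 0 ≤ q) (hr : 0 < r)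
    (h : Real.exp 2 * n * q ≤ r) : n.choose r * q ^ r ≤ Real.exp (-r) := by
  have hr' : (0 : ℝ) < r := by exact_mod_cast hr
  have h1 := Nat.choose_le_pow_div (α := ℝ) r n
  have h2 := Real.pow_div_factorial_le_exp (r : ℝ) hr'.le r
  have h3 : n * q ≤ r * Real.exp (-2) := by
    rw [Real.exp_neg, ← div_eq_mul_inv, le_div_iff₀ (Real.exp_pos 2)]
    linarith
  calc n.choose r * q ^ r ≤ (n : ℝ) ^ r / r.factorial * q ^ r := by gcongr
    _ = (n * q) ^ r / r.factorial := by rw [mul_pow]; ring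
    _ ≤ (r * Real.exp (-2)) ^ r / r.factorial := by gcongr
    _ = (r : ℝ) ^ r / r.factorial * Real.exp (-2) ^ r := by rw [mul_pow]; ring
    _ ≤ Real.exp r * Real.exp (-2) ^ r := by gcongr
    _ = Real.exp (-r) := by
        rw [← Real.exp_nat_mul, ← Real.exp_add]
        congr 1
        ring

theorem exists_even_sub {n f : ℕ} (hf₀ : 0 < f) (hf : f ≤ n) :
    ∃ r a, n = r + 2 * a ∧ r ≤ f ∧ f ≤ r + 1 :=
  ⟨n - 2 * ((n - f + 1) / 2), (n - f + 1) / 2, by omega, by omega, by omega⟩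

/-- The quantitative version of the theorem, for `n` with `L = log n` large enough. -/
theorem one_sub_exp_le_gprob {n : ℕ} {L E : ℝ} (hL : L = Real.log n) (hL4 : 4 ≤ L)
    (hE1 : 1 ≤ E) (hEL : E ≤ L) (hsqrt : (8 + L ^ 2) * L ≤ Real.exp (L / 2))
    (hexp : 2 * Real.exp 3 * Real.exp ((L - E) / 2) ≤ L ^ 2 - 1) :
    1 - Real.exp (L + 2 - L ^ 2) ≤ gprob {G : SimpleGraph (Fin n) |
      ∀ y : ℤ, (1 / 2) * √(n * E) - 2 ≤ |(y : ℝ) - (n : ℝ) / 2| →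
        (Ncount G y : ℝ) ≤ L ^ 2} := by
  have hn0 : (0 : ℝ) < n := by
    rcases Nat.eq_zero_or_pos n with h | h
    · simp [h] at hL
      linarith
    · exact_mod_cast h
  have hexpL : Real.exp L = n := by rw [hL, Real.exp_log hn0]
  have hroot : √(n : ℝ) = Real.exp (L / 2) := by
    rw [← hexpL, Real.sqrt_eq_iff_mul_self_eq (by positivity) (by positivity), ← Real.exp_add]
    ring_nf
  have hroot2 : √(n : ℝ) * √(n : ℝ) = n := Real.mul_self_sqrt hn0.le
  rw [← hroot] at hsqrt
  have hL2 : 16 ≤ L ^ 2 := by nlinarith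
  have hroot4 : 4 * (8 + L ^ 2) ≤ √(n : ℝ) := by nlinarith
  have hbig : 4 * (8 + L ^ 2) ≤ n := by nlinarith
  have hfloor := Nat.floor_le (sq_nonneg L)
  have hfloor' := Nat.lt_floor_add_one (L ^ 2)
  set f := ⌊L ^ 2⌋₊ + 1 with hf
  have hfn : (f : ℝ) ≤ n := by
    rw [hf]
    push_cast
    linarith
  obtain ⟨r, a, hra, hrf, hfr⟩ := exists_even_sub (n := n) (f := f) (by omega) (by exact_mod_cast hfn)
  have hrf' : (r : ℝ) ≤ ⌊L ^ 2⌋₊ + 1 := by exact_mod_cast hrf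
  have hfr' : (⌊L ^ 2⌋₊ : ℝ) ≤ r := by exact_mod_cast (by omega : ⌊L ^ 2⌋₊ ≤ r)
  have hr0 : (0 : ℝ) < r := by linarith
  have hra' : (n : ℝ) = r + 2 * a := by exact_mod_cast hra
  have hs : (r : ℝ) / 2 + 3 ≤ (8 + L ^ 2) / 2 := by linarith
  have ha4 : (n : ℝ) / 4 ≤ 2 * a + 1 := by linarith
  have ha0 : 0 < a := by
    have : (0 : ℝ) < a := by linarith
    exact_mod_cast this
  have hsqE : √E ≤ L := Real.sqrt_le_iff.2 ⟨by linarith, by nlinarith⟩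
  have hsqE1 : 1 ≤ √E := Real.one_le_sqrt.2 hE1
  have hW : √(n * E) = √n * √E := Real.sqrt_mul hn0.le E
  have hrootpos : 0 < √(n : ℝ) := by rw [hroot]; positivity
  have key := one_sub_le_gprob_forall_Ncount_le (n := n) (r := r) (K := L ^ 2)
    (q := Real.exp (1 - E / 2) / √(2 * a + 1)) (sq_nonneg L) (fun N hN => by
      have : ⌊L ^ 2⌋₊ < N := (Nat.floor_lt (sq_nonneg L)).2 hN
      omega) (by positivity)
    (fun y : ℤ => (1 / 2) * √(n * E) - 2 ≤ |(y : ℝ) - (n : ℝ) / 2|)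
    (fun y hy d k hd hk => by
      rw [show n - r = 2 * a by omega]
      refine choose_le_of_far_from_mean hra ha0 (by linarith) ?_ ?_ (by simpa using hy) hd hk
      · rw [hW]
        nlinarith
      · rw [hW]
        calc 4 * (1 / 2 * (√n * √E)) * ((r : ℝ) / 2 + 3)
            ≤ 4 * (1 / 2 * (√n * L)) * ((8 + L ^ 2) / 2) := by gcongr
          _ = √n * ((8 + L ^ 2) * L) := by ring
          _ ≤ √n * √n := by gcongr
          _ = n := hroot2)
  refine le_trans ?_ key
  rw [sub_le_sub_iff_left]
  have hq : Real.exp 2 * n * (Real.exp (1 - E / 2) / √(2 * a + 1)) ≤ r := by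
    have h4 : √n / 2 ≤ √(2 * a + 1) := by
      rw [show √(n : ℝ) / 2 = √(n / 4) by
        rw [Real.sqrt_div hn0.le, show (4 : ℝ) = 2 ^ 2 by norm_num, Real.sqrt_sq (by norm_num)]]
      exact Real.sqrt_le_sqrt ha4
    calc Real.exp 2 * n * (Real.exp (1 - E / 2) / √(2 * a + 1))
        ≤ Real.exp 2 * n * (Real.exp (1 - E / 2) / (√n / 2)) := by gcongr
      _ = 2 * √n * (Real.exp 2 * Real.exp (1 - E / 2)) := by
          nth_rw 1 [← hroot2]
          field_simp
      _ = 2 * Real.exp 3 * Real.exp ((L - E) / 2) := by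
          rw [hroot, mul_assoc, mul_assoc, ← Real.exp_add, ← Real.exp_add, ← Real.exp_add]
          ring_nf
      _ ≤ r := by linarith
  have hn1 : (n : ℝ) + 1 ≤ Real.exp (L + 1) := by
    rw [Real.exp_add, hexpL]
    have h1 : (1 : ℝ) ≤ n := by exact_mod_cast (Nat.cast_pos.1 hn0)
    nlinarith [Real.add_one_le_exp (1 : ℝ)]
  calc ((n : ℝ) + 1) * (n.choose r * (Real.exp (1 - E / 2) / √(2 * a + 1)) ^ r)
      ≤ Real.exp (L + 1) * Real.exp (-r) :=
        mul_le_mul hn1 (choose_mul_pow_le (by positivity) (by exact_mod_cast hr0) hq)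
          (by positivity) (by positivity)
    _ ≤ Real.exp (L + 2 - L ^ 2) := by
        rw [← Real.exp_add]
        gcongr
        linarith

theorem eventually_log_bounds (c : ℝ) : ∀ᶠ L : ℝ in atTop,
    1 ≤ L - (c + 5 / 2 * Real.log L) ∧ 0 ≤ c + 5 / 2 * Real.log L ∧
      (8 + L ^ 2) * L ≤ Real.exp (L / 2) ∧
      2 * Real.exp 3 * Real.exp ((c + 5 / 2 * Real.log L) / 2) ≤ L ^ 2 - 1 := by
  have hlog : Tendsto Real.log atTop atTop := Real.tendsto_log_atTop
  have h1 : ∀ᶠ L : ℝ in atTop, |Real.log L| ≤ 1 / 10 * |L| := by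
    simpa using Real.isLittleO_log_id_atTop.bound (by norm_num : (0 : ℝ) < 1 / 10)
  have h3 : ∀ᶠ L : ℝ in atTop, L ^ 4 ≤ Real.exp (L / 2) := by
    have := (isLittleO_pow_exp_pos_mul_atTop 4 (by norm_num : (0 : ℝ) < 1 / 2)).bound one_pos
    filter_upwards [this] with L hL
    rw [one_mul, Real.norm_of_nonneg (by positivity), Real.norm_of_nonneg (by positivity)] at hL
    rwa [div_eq_inv_mul, ← one_div]
  have h4 : ∀ᶠ L : ℝ in atTop, Real.log 4 + 3 + c / 2 ≤ 3 / 4 * Real.log L :=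
    (hlog.const_mul_atTop (by norm_num)).eventually_ge_atTop _
  filter_upwards [h1, h3, h4, eventually_ge_atTop 4, eventually_ge_atTop (2 * (1 + c)),
    hlog.eventually_ge_atTop (-c)] with L h1 h3 h4 hL4 hLc hlc
  have hL0 : 0 < L := by linarith
  have hlogL : 0 ≤ Real.log L := Real.log_nonneg (by linarith)
  rw [abs_of_nonneg hlogL, abs_of_pos hL0] at h1
  refine ⟨by linarith, by linarith, ?_, ?_⟩
  · refine le_trans ?_ h3
    nlinarith [mul_pos hL0 hL0, mul_nonneg hL0.le (sub_nonneg.2 hL4),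
      mul_nonneg (mul_pos (mul_pos hL0 hL0) hL0).le (sub_nonneg.2 hL4)]
  · have h5 : 4 * Real.exp 3 * Real.exp ((c + 5 / 2 * Real.log L) / 2) ≤ L ^ 2 := by
      have e4 : Real.exp (Real.log 4) = 4 := Real.exp_log (by norm_num)
      have eL : Real.exp (2 * Real.log L) = L ^ 2 := by
        rw [two_mul, Real.exp_add, Real.exp_log hL0, sq]
      rw [← eL, ← e4, ← Real.exp_add, ← Real.exp_add]
      gcongr
      linarith
    nlinarith

/-- Whp, for every integer `y` with
`(1/2)·√(n·ln n·(1−ζ₂)) − 2 ≤ |y − n/2| ≤ (1/2)·√(n·ln n·(1−ζ₁)) + 2`,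
one has `N_y ≤ (ln n)²`. -/
theorem rare_degrees_whp :
    Tendsto (fun n : ℕ => gprob {G : SimpleGraph (Fin n) |
      ∀ y : ℤ,
        (1 / 2) * Real.sqrt ((n : ℝ) * Real.log n * (1 - zeta2 n)) - 2 ≤
            |(y : ℝ) - (n : ℝ) / 2| →
        |(y : ℝ) - (n : ℝ) / 2| ≤
            (1 / 2) * Real.sqrt ((n : ℝ) * Real.log n * (1 - zeta1 n)) + 2 →
        (Ncount G y : ℝ) ≤ Real.log n ^ 2}) atTop (nhds 1) := by
  have hL : Tendsto (fun n : ℕ => Real.log n) atTop atTop :=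
    Real.tendsto_log_atTop.comp tendsto_natCast_atTop_atTop
  have hpoly : Tendsto (fun L : ℝ => L + 2 - L ^ 2) atTop atBot := by
    refine tendsto_atBot_mono' _ ?_ tendsto_neg_atTop_atBot
    filter_upwards [eventually_ge_atTop 4] with L hL
    nlinarith
  have hlower : Tendsto (fun n : ℕ => 1 - Real.exp (Real.log n + 2 - Real.log n ^ 2)) atTop
      (nhds 1) := by
    simpa using (Real.tendsto_exp_atBot.comp (hpoly.comp hL)).const_sub 1
  refine tendsto_of_tendsto_of_tendsto_of_le_of_le' hlower tendsto_const_nhds ?_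
    (Eventually.of_forall fun n => gprob_le_one _)
  filter_upwards [hL.eventually (eventually_log_bounds (Real.log (2 * Real.pi))),
    hL.eventually_ge_atTop 4] with n ⟨hE1, hEL, hsqrt, hexp⟩ hL4
  refine (one_sub_exp_le_gprob rfl hL4 hE1 (by linarith) hsqrt (by
    rwa [sub_sub_cancel])).trans (gprob_mono ?_)
  intro G hG y hy _
  refine hG y (le_of_eq_of_le ?_ hy)
  have hL0 : Real.log n ≠ 0 := by linarith
  rw [zeta2, mul_assoc, mul_one_sub, mul_div_cancel₀ _ hL0]
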